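/- Fix a composition α. Let w = 𝔱_i 𝔡_I with i ∈ I, 𝔱_i 𝔡_I(α) ≠ 0, and write I = A ⊔ {i} ⊔ B with A = {j ∈ I : j < i}, B = {j ∈ I : j > i}. Let k be the largest part of α strictly less than i (k = 0 if there is none), let i' = k + 1, let I' = A ⊔ {i'} ⊔ B, and set w' = Φ(w) = 𝔡_{I'} 𝔱_{i'}. Then: (1) if i = 1 then w'(α) = w(α); (2) if i ≥ 2 and i is not the smallest part of 𝔡_B(α) then w'(α) = w(α); (3) if i ≥ 2 and i is the smallest part of 𝔡_B(α) then w'(α) = (0, w(α)), i.e. w(α) with an extra part 0 prepended. In particular, 𝔡_{I'} 𝔱_{i'}(α) ≠ 0 and the underlying compositions of Φ(w)(α) and w(α) are equal. -/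

import Mathlib

namespace CompOps

/-- Subtract 1 from the rightmost part equal to `i`; `none` if no part equals `i`. -/
def removeAux (i : ℕ) : List ℕ → Option (List ℕ)
  | [] => none
  | x :: xs =>
    match removeAux i xs with
    | some ys => some (x :: ys)
    | none => if x = i then some ((i - 1) :: xs) else none

/-- The box removing operator `𝔡ᵢ`, acting on weak compositions together with a
formal zero (`none`); `𝔡₀` is the identity. -/
def d : ℕ → Option (List ℕ) → Option (List ℕ)
  | 0, o => o
  | i + 1, o => o.bind (removeAux (i + 1))

/-- The appending operator `aᵢ`, appending a part `i` at the end. -/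
def a (i : ℕ) : Option (List ℕ) → Option (List ℕ) :=
  Option.map (fun l => l ++ [i])

/-- `𝔡_I` for a finite set `I = {i₁ < ⋯ < i_k}`: the composite
`𝔡_{i₁}𝔡_{i₂}⋯𝔡_{i_k}`, where `𝔡_{i_k}` (the largest index) acts first. -/
def dSet (I : Finset ℕ) : Option (List ℕ) → Option (List ℕ) :=
  (I.sort (· ≤ ·)).foldr (fun i f => d i ∘ f) id

/-- The jdt operator `𝔲ᵢ = aᵢ 𝔡_{[i-1]}` (with `𝔲₀` the identity). -/
def u : ℕ → Option (List ℕ) → Option (List ℕ)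
  | 0 => id
  | i + 1 => a (i + 1) ∘ dSet (Finset.Icc 1 i)

/-- Add 1 to the leftmost part equal to `j`; `none` if no part equals `j`. -/
def addAux (j : ℕ) : List ℕ → Option (List ℕ)
  | [] => none
  | x :: xs => if x = j then some ((x + 1) :: xs) else (addAux j xs).map (x :: ·)

/-- The box adding operator `𝔱ᵢ`: `𝔱₁` prepends a part 1, and for `i ≥ 2`, `𝔱ᵢ`
adds 1 to the leftmost part equal to `i - 1` (formal zero if there is none). -/
def t : ℕ → Option (List ℕ) → Option (List ℕ)
  | 0 => id
  | 1 => Option.map (fun l => 1 :: l)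
  | i + 2 => fun o => o.bind (addAux (i + 1))

/-! ### Box operators on a single list -/

theorem removeAux_eq_none {j : ℕ} {l : List ℕ} : removeAux j l = none ↔ j ∉ l := by
  induction l with
  | nil => simp [removeAux]
  | cons x xs ih =>
    unfold removeAux
    cases h : removeAux j xs <;> grind

theorem exists_removeAux {j : ℕ} {l : List ℕ} (h : j ∈ l) : ∃ l', removeAux j l = some l' := by
  have := (removeAux_eq_none (j := j) (l := l)).not
  exact Option.ne_none_iff_exists'.mp (this.mpr (not_not.mpr h))

theorem addAux_eq_none {m : ℕ} {l : List ℕ} : addAux m l = none ↔ m ∉ l := by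
  induction l with
  | nil => simp [addAux]
  | cons x xs ih =>
    unfold addAux
    split_ifs <;> simp [*, Ne.symm]

theorem mem_of_removeAux_ne {j p : ℕ} {l l' : List ℕ} (h : removeAux j l = some l')
    (hp : p ≠ j) (hp' : p + 1 ≠ j) (hj : 0 < j) : p ∈ l' ↔ p ∈ l := by
  induction l generalizing l' with
  | nil => simp [removeAux] at h
  | cons x xs ih =>
    unfold removeAux at h
    cases hx : removeAux j xs <;> grind

theorem count_removeAux_succ {m : ℕ} {l l' : List ℕ} (h : removeAux (m + 1) l = some l') :
    l'.count m = l.count m + 1 := by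
  induction l generalizing l' with
  | nil => simp [removeAux] at h
  | cons x xs ih =>
    unfold removeAux at h
    cases hx : removeAux (m + 1) xs <;> grind

theorem count_removeAux_self {m : ℕ} {l l' : List ℕ} (hm : 0 < m)
    (h : removeAux m l = some l') : l'.count m + 1 = l.count m := by
  induction l generalizing l' with
  | nil => simp [removeAux] at h
  | cons x xs ih =>
    unfold removeAux at h
    cases hx : removeAux m xs <;> grind

theorem removeAux_cons_of_ne {j x : ℕ} (h : x ≠ j) (xs : List ℕ) :
    removeAux j (x :: xs) = (removeAux j xs).map (x :: ·) := by
  cases hr : removeAux j xs <;> simp [removeAux, hr, h]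

theorem removeAux_cons_of_mem {j : ℕ} {xs : List ℕ} (h : j ∈ xs) (x : ℕ) :
    removeAux j (x :: xs) = (removeAux j xs).map (x :: ·) := by
  obtain ⟨ys, hr⟩ := exists_removeAux h
  simp [removeAux, hr]

theorem removeAux_cons_self {j : ℕ} {xs : List ℕ} (h : j ∉ xs) :
    removeAux j (j :: xs) = some ((j - 1) :: xs) := by
  simp [removeAux, removeAux_eq_none.mpr h]

theorem addAux_cons_self (m : ℕ) (xs : List ℕ) : addAux m (m :: xs) = some ((m + 1) :: xs) := by
  simp [addAux]

theorem addAux_cons_of_ne {m x : ℕ} (h : x ≠ m) (xs : List ℕ) :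
    addAux m (x :: xs) = (addAux m xs).map (x :: ·) := by
  simp [addAux, h]

theorem mem_addAux_of_mem {m p : ℕ} {l l' : List ℕ} (h : addAux m l = some l') (hp : p ≠ m)
    (hl : p ∈ l) : p ∈ l' := by
  induction l generalizing l' with
  | nil => simp at hl
  | cons x xs ih =>
    unfold addAux at h
    cases hx : addAux m xs <;> grind

theorem mem_of_mem_addAux {m p : ℕ} {l l' : List ℕ} (h : addAux m l = some l') (hp : p ≠ m + 1)
    (hl : p ∈ l') : p ∈ l := by
  induction l generalizing l' with
  | nil => simp [addAux] at h
  | cons x xs ih =>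
    unfold addAux at h
    cases hx : addAux m xs <;> grind

theorem succ_mem_addAux {m : ℕ} {l l' : List ℕ} (h : addAux m l = some l') : m + 1 ∈ l' := by
  induction l generalizing l' with
  | nil => simp [addAux] at h
  | cons x xs ih =>
    unfold addAux at h
    cases hx : addAux m xs <;> grind

theorem map_cons_bind {x : ℕ} {o : Option (List ℕ)} {f : List ℕ → Option (List ℕ)}
    (h : ∀ l, o = some l → f (x :: l) = (f l).map (x :: ·)) :
    (o.map (x :: ·)).bind f = (o.bind f).map (x :: ·) := by
  cases o with
  | none => rfl
  | some l => simpa using h l rfl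

theorem removeAux_addAux_comm {j m : ℕ} (hj : 0 < j) (h₁ : j ≠ m) (h₂ : j ≠ m + 1)
    (l : List ℕ) : (addAux m l).bind (removeAux j) = (removeAux j l).bind (addAux m) := by
  induction l with
  | nil => simp [removeAux, addAux]
  | cons x xs ih =>
    by_cases hx : x = m
    · subst hx
      rw [addAux_cons_self, removeAux_cons_of_ne h₁.symm, Option.bind_some,
        removeAux_cons_of_ne h₂.symm]
      cases removeAux j xs <;> simp [addAux]
    rw [addAux_cons_of_ne hx]
    by_cases hxj : x = j ∧ j ∉ xs
    · obtain ⟨rfl, hxs⟩ := hxj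
      rw [removeAux_cons_self hxs, Option.bind_some, addAux_cons_of_ne (by omega)]
      cases ha : addAux m xs with
      | none => rfl
      | some zs => simp [removeAux_cons_self (fun h => hxs (mem_of_mem_addAux ha h₂ h))]
    · have hcons : removeAux j (x :: xs) = (removeAux j xs).map (x :: ·) := by
        by_cases hx' : x = j
        · exact removeAux_cons_of_mem (by tauto) x
        · exact removeAux_cons_of_ne hx' xs
      rw [hcons, map_cons_bind fun l _ => addAux_cons_of_ne hx l, ← ih]
      refine map_cons_bind fun l hl => ?_
      by_cases hx' : x = j
      · exact removeAux_cons_of_mem (mem_addAux_of_mem hl h₁ (by tauto)) x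
      · exact removeAux_cons_of_ne hx' l

theorem removeAux_succ_addAux {m : ℕ} {l : List ℕ} (hm : m ∈ l) (hm' : m + 1 ∉ l) :
    (addAux m l).bind (removeAux (m + 1)) = some l := by
  induction l with
  | nil => simp at hm
  | cons x xs ih =>
    rw [List.mem_cons, not_or] at hm'
    by_cases hx : x = m
    · subst hx
      simp [addAux_cons_self, removeAux_cons_self hm'.2]
    · rw [addAux_cons_of_ne hx, map_cons_bind fun l _ => removeAux_cons_of_ne (Ne.symm hm'.1) l,
        ih (List.mem_of_ne_of_mem (Ne.symm hx) hm) hm'.2]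
      rfl

theorem addAux_removeAux_succ {m : ℕ} {l : List ℕ} (hm : m ∉ l) (hm' : m + 1 ∈ l) :
    (removeAux (m + 1) l).bind (addAux m) = some l := by
  induction l with
  | nil => simp at hm'
  | cons x xs ih =>
    rw [List.mem_cons, not_or] at hm
    by_cases hxs : m + 1 ∈ xs
    · rw [removeAux_cons_of_mem hxs, map_cons_bind fun l _ => addAux_cons_of_ne (Ne.symm hm.1) l,
        ih hm.2 hxs]
      rfl
    · obtain rfl : m + 1 = x := (List.mem_cons.mp hm').resolve_right hxs
      simp [removeAux_cons_self hxs, addAux_cons_self]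

theorem removeAux_succ_addAux_comm {m : ℕ} {l : List ℕ} (hm : m ∈ l) (hm' : m + 1 ∈ l) :
    (addAux m l).bind (removeAux (m + 1)) = (removeAux (m + 1) l).bind (addAux m) := by
  induction l with
  | nil => simp at hm
  | cons x xs ih =>
    by_cases hx : x = m
    · subst hx
      have hxs : x + 1 ∈ xs := List.mem_of_ne_of_mem (by omega) hm'
      rw [addAux_cons_self, Option.bind_some, removeAux_cons_of_mem hxs,
        removeAux_cons_of_mem hxs]
      cases removeAux (x + 1) xs <;> simp [addAux]
    · have hmxs : m ∈ xs := List.mem_of_ne_of_mem (Ne.symm hx) hm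
      rw [addAux_cons_of_ne hx,
        map_cons_bind fun l hl => removeAux_cons_of_mem (succ_mem_addAux hl) x]
      by_cases hxs : m + 1 ∈ xs
      · rw [removeAux_cons_of_mem hxs, map_cons_bind fun l _ => addAux_cons_of_ne hx l,
          ih hmxs hxs]
      · obtain rfl : m + 1 = x := (List.mem_cons.mp hm').resolve_right hxs
        simp [removeAux_cons_self hxs, addAux_cons_self, removeAux_succ_addAux hmxs hxs]

theorem removeAux_addAux_self_comm {m : ℕ} {l : List ℕ} (hm : 2 ≤ l.count m) :
    (addAux m l).bind (removeAux m) = (removeAux m l).bind (addAux m) := by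
  induction l with
  | nil => simp at hm
  | cons x xs ih =>
    by_cases hx : x = m
    · subst hx
      rw [List.count_cons_self] at hm
      rw [addAux_cons_self, Option.bind_some, removeAux_cons_of_ne (by omega),
        removeAux_cons_of_mem (List.count_pos_iff.mp (by omega))]
      cases removeAux x xs <;> simp [addAux]
    · rw [List.count_cons_of_ne hx] at hm
      rw [addAux_cons_of_ne hx, removeAux_cons_of_ne hx,
        map_cons_bind fun l _ => removeAux_cons_of_ne hx l,
        map_cons_bind fun l _ => addAux_cons_of_ne hx l, ih hm]

/-! ### Box operators with a formal zero -/

theorem d_of_pos {j : ℕ} (hj : 0 < j) (o : Option (List ℕ)) : d j o = o.bind (removeAux j) := by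
  cases j with
  | zero => omega
  | succ j => rfl

theorem t_of_two_le {i : ℕ} (hi : 2 ≤ i) (o : Option (List ℕ)) :
    t i o = o.bind (addAux (i - 1)) := by
  match i, hi with
  | i + 2, _ => rfl

theorem t_none {i : ℕ} : t i none = none := by
  match i with
  | 0 => rfl
  | 1 => rfl
  | i + 2 => rfl

theorem d_none {i : ℕ} : d i none = none := by
  cases i <;> rfl

theorem d_t_comm {i j : ℕ} (hi : 0 < i) (hj : 0 < j) (h₁ : j ≠ i) (h₂ : j + 1 ≠ i)
    (o : Option (List ℕ)) : d j (t i o) = t i (d j o) := by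
  cases o with
  | none => simp [t_none, d_none]
  | some l =>
    rw [d_of_pos hj, d_of_pos hj]
    obtain rfl | hi := (show i = 1 ∨ 2 ≤ i by omega)
    · cases h : removeAux j l <;> simp [t, removeAux, h, Ne.symm h₁]
    · rw [t_of_two_le hi, t_of_two_le hi]
      exact removeAux_addAux_comm hj (by omega) (by omega) l

theorem dSet_singleton (i : ℕ) : dSet {i} = d i := by
  simp [dSet]

theorem dSet_union {S T : Finset ℕ} (h : ∀ a ∈ S, ∀ b ∈ T, a < b) (o : Option (List ℕ)) :
    dSet (S ∪ T) o = dSet S (dSet T o) := by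
  have hs : (S ∪ T).sort (· ≤ ·) = S.sort (· ≤ ·) ++ T.sort (· ≤ ·) := by
    have hp : (S ∪ T) = (S.sort (· ≤ ·) ++ T.sort (· ≤ ·)).toFinset := by
      simp
    rw [hp]
    refine (List.toFinset_sort _ ?_).mpr ?_
    · refine List.nodup_append.mpr ⟨S.sort_nodup _, T.sort_nodup _, fun a ha b hb => ?_⟩
      exact (h a (by simpa using ha) b (by simpa using hb)).ne
    · refine List.pairwise_append.mpr ⟨S.pairwise_sort _, T.pairwise_sort _, fun a ha b hb => ?_⟩
      exact (h a (by simpa using ha) b (by simpa using hb)).le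
  have hf : ∀ L : List ℕ, ∀ f : Option (List ℕ) → Option (List ℕ),
      L.foldr (fun i f => d i ∘ f) f o = L.foldr (fun i f => d i ∘ f) id (f o) := by
    intro L f
    induction L with
    | nil => rfl
    | cons x xs ih => simp [ih]
  rw [dSet, hs, List.foldr_append, hf]
  rfl

theorem dSet_none (S : Finset ℕ) : dSet S none = none := by
  unfold dSet
  generalize S.sort (· ≤ ·) = L at *
  induction L with
  | nil => rfl
  | cons x xs ih => simp [ih, d_none]

theorem dSet_comm {F : Option (List ℕ) → Option (List ℕ)} {S : Finset ℕ}
    (h : ∀ j ∈ S, ∀ o, d j (F o) = F (d j o)) (o : Option (List ℕ)) :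
    dSet S (F o) = F (dSet S o) := by
  have h' : ∀ j ∈ S.sort (· ≤ ·), ∀ o, d j (F o) = F (d j o) := by simpa using h
  unfold dSet
  generalize S.sort (· ≤ ·) = L at *
  induction L with
  | nil => rfl
  | cons x xs ih =>
    simp only [List.mem_cons, forall_eq_or_imp] at h'
    simp [ih h'.2, h'.1]

theorem mem_iff_of_dSet_eq_some {S : Finset ℕ} {p : ℕ} {l l' : List ℕ}
    (hS : ∀ j ∈ S, 0 < j ∧ p ≠ j ∧ p + 1 ≠ j) (h : dSet S (some l) = some l') :
    p ∈ l' ↔ p ∈ l := by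
  have hS' : ∀ j ∈ S.sort (· ≤ ·), 0 < j ∧ p ≠ j ∧ p + 1 ≠ j := by simpa using hS
  unfold dSet at h
  generalize S.sort (· ≤ ·) = L at *
  induction L generalizing l' with
  | nil => simp at h; simp [h]
  | cons x xs ih =>
    simp only [List.mem_cons, forall_eq_or_imp] at hS'
    simp only [List.foldr_cons, Function.comp_apply, d_of_pos hS'.1.1,
      Option.bind_eq_some_iff] at h
    obtain ⟨m, hm, hm'⟩ := h
    exact (mem_of_removeAux_ne hm' hS'.1.2.1 hS'.1.2.2 hS'.1.1).trans (ih hm hS'.2)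

/-- If all elements of `S` are less than `i`, and `l` has no part in `(k, i)`, then `𝔡_S l ≠ 0`
forces all elements of `S` to be at most `k`. -/
theorem le_of_dSet_ne_none {S : Finset ℕ} {k i : ℕ} {l : List ℕ} (hS : ∀ j ∈ S, 0 < j ∧ j < i)
    (hl : ∀ p ∈ l, p < i → p ≤ k) (h : dSet S (some l) ≠ none) : ∀ j ∈ S, j ≤ k := by
  by_contra! hc
  obtain ⟨j, hj, hkj⟩ := hc
  have hne : S.Nonempty := ⟨j, hj⟩
  set M := S.max' hne
  have hM : M ∈ S := S.max'_mem hne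
  have hjM : j ≤ M := S.le_max' j hj
  have hU : S = S.erase M ∪ {M} := by
    ext x; simp only [Finset.mem_union, Finset.mem_erase, Finset.mem_singleton]
    grind
  rw [hU, dSet_union (by
      intro a ha b hb
      rw [Finset.mem_singleton] at hb
      subst hb
      exact lt_of_le_of_ne (S.le_max' a (Finset.mem_of_mem_erase ha)) (Finset.ne_of_mem_erase ha)),
    dSet_singleton, d_of_pos (hS M hM).1, Option.bind_some,
    removeAux_eq_none.mpr (fun hm => by have := hl M hm (hS M hM).2; omega), dSet_none] at h
  exact h rfl

theorem dSet_lt_t_comm {A : Finset ℕ} {i : ℕ} (hi : 2 ≤ i) (hA : ∀ j ∈ A, 0 < j ∧ j < i)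
    {l : List ℕ} (hl : 2 ≤ l.count (i - 1)) :
    dSet A (t i (some l)) = t i (dSet A (some l)) := by
  by_cases hm : i - 1 ∈ A
  · have hU : A = A.erase (i - 1) ∪ {i - 1} := by
      ext x; simp only [Finset.mem_union, Finset.mem_erase, Finset.mem_singleton]
      grind
    have hlt : ∀ a ∈ A.erase (i - 1), ∀ b ∈ ({i - 1} : Finset ℕ), a < b := by
      intro a ha b hb
      have := hA a (Finset.mem_of_mem_erase ha)
      have := Finset.ne_of_mem_erase ha
      rw [Finset.mem_singleton] at hb
      omega
    rw [hU, dSet_union hlt, dSet_union hlt, dSet_singleton]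
    have : d (i - 1) (t i (some l)) = t i (d (i - 1) (some l)) := by
      rw [d_of_pos (by omega), d_of_pos (by omega), t_of_two_le hi, t_of_two_le hi]
      exact removeAux_addAux_self_comm hl
    rw [this]
    refine dSet_comm (fun j hj o => ?_) _
    have := hA j (Finset.mem_of_mem_erase hj)
    have := Finset.ne_of_mem_erase hj
    exact d_t_comm (by omega) (by omega) (by omega) (by omega) o
  · refine dSet_comm (fun j hj o => ?_) _
    have := hA j hj
    have : j ≠ i - 1 := fun h => hm (h ▸ hj)
    exact d_t_comm (by omega) (by omega) (by omega) (by omega) o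

/-- If `i - 1` is a part of `β`, then `𝔡_A 𝔡ᵢ 𝔱ᵢ β = 𝔱ᵢ 𝔡_A 𝔡ᵢ β`. -/
theorem dSet_d_t_of_mem {A : Finset ℕ} {i : ℕ} {β : List ℕ} (hi : 2 ≤ i)
    (hA : ∀ j ∈ A, 0 < j ∧ j < i) (hβ : i ∈ β) (hβ' : i - 1 ∈ β) :
    dSet A (d i (t i (some β))) = t i (dSet A (d i (some β))) := by
  obtain ⟨m, rfl⟩ : ∃ m, i = m + 1 := ⟨i - 1, by omega⟩
  rw [Nat.add_sub_cancel] at hβ'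
  have hc : d (m + 1) (t (m + 1) (some β)) = t (m + 1) (d (m + 1) (some β)) := by
    rw [t_of_two_le hi, t_of_two_le hi]
    exact removeAux_succ_addAux_comm hβ' hβ
  rw [hc]
  obtain ⟨γ, hγ⟩ := exists_removeAux hβ
  have hd : d (m + 1) (some β) = some γ := hγ
  rw [hd]
  refine dSet_lt_t_comm hi hA ?_
  have := count_removeAux_succ hγ
  have := List.count_pos_iff.mpr hβ'
  simp only [Nat.add_sub_cancel]
  omega

/-- If `i - 1` is not a part of `β` and `𝔱ᵢ 𝔡_A 𝔡ᵢ β ≠ 0`, then it equals `𝔡_A β`. -/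
theorem t_dSet_d_of_notMem {A : Finset ℕ} {i : ℕ} {β : List ℕ} (hi : 2 ≤ i)
    (hA : ∀ j ∈ A, 0 < j ∧ j < i) (hβ : i ∈ β) (hβ' : i - 1 ∉ β)
    (h : t i (dSet A (d i (some β))) ≠ none) :
    t i (dSet A (d i (some β))) = dSet A (some β) := by
  obtain ⟨m, rfl⟩ : ∃ m, i = m + 1 := ⟨i - 1, by omega⟩
  rw [Nat.add_sub_cancel] at hβ'
  obtain ⟨γ, hγ⟩ := exists_removeAux hβ
  have hd : d (m + 1) (some β) = some γ := hγ
  have hm : m ∉ A := by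
    intro hm
    have hU : A = A.erase m ∪ {m} := by
      ext x; simp only [Finset.mem_union, Finset.mem_erase, Finset.mem_singleton]
      grind
    have hlt : ∀ a ∈ A.erase m, ∀ b ∈ ({m} : Finset ℕ), a < b := by
      intro a ha b hb
      have := hA a (Finset.mem_of_mem_erase ha)
      have := Finset.ne_of_mem_erase ha
      rw [Finset.mem_singleton] at hb
      omega
    rw [hU, dSet_union hlt, dSet_singleton, hd, d_of_pos (by omega), Option.bind_some] at h
    have hc := count_removeAux_succ hγ
    rw [List.count_eq_zero.mpr hβ'] at hc
    obtain ⟨δ, hδ⟩ := exists_removeAux (List.count_pos_iff.mp (by omega : 0 < γ.count m))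
    have hc' := count_removeAux_self (by omega) hδ
    have hδm : m ∉ δ := List.count_eq_zero.mp (by omega)
    rw [hδ] at h
    cases he : dSet (A.erase m) (some δ) with
    | none => rw [he, t_none] at h; exact h rfl
    | some ε =>
      have := mem_iff_of_dSet_eq_some (p := m) (fun j hj => by
        have := hA j (Finset.mem_of_mem_erase hj)
        have := Finset.ne_of_mem_erase hj
        omega) he
      rw [he, t_of_two_le hi, Option.bind_some, Nat.add_sub_cancel,
        addAux_eq_none.mpr (this.not.mpr hδm)] at h
      exact h rfl
  have hcomm : ∀ o, dSet A (t (m + 1) o) = t (m + 1) (dSet A o) := by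
    refine dSet_comm (fun j hj o => ?_)
    have := hA j hj
    have : j ≠ m := fun h => hm (h ▸ hj)
    exact d_t_comm (by omega) (by omega) (by omega) (by omega) o
  rw [← hcomm, t_of_two_le hi]
  exact congrArg (dSet A) (addAux_removeAux_succ hβ' hβ)

theorem le_foldr_max {l : List ℕ} {x : ℕ} (h : x ∈ l) : x ≤ l.foldr max 0 := by
  induction l with
  | nil => simp at h
  | cons y ys ih => grind

theorem foldr_max_eq_zero_or_mem (l : List ℕ) : l.foldr max 0 = 0 ∨ l.foldr max 0 ∈ l := by
  induction l with
  | nil => simp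
  | cons y ys ih => grind

/-- The comparison of `𝔡_{I'} 𝔱_{k+1}` and `𝔱ᵢ 𝔡_I`, with `k` characterised by its properties. -/
theorem dSet_insert_t_eq {α : List ℕ} {I : Finset ℕ} (hI : ∀ j ∈ I, 0 < j) {i : ℕ} (hi : i ∈ I)
    (hw : t i (dSet I (some α)) ≠ none) {k : ℕ} (hki : k < i) (hk : k = 0 ∨ k ∈ α)
    (hmax : ∀ p ∈ α, p < i → p ≤ k) :
    ∃ β, dSet (I.filter (fun j => i < j)) (some α) = some β ∧ i ∈ β ∧
      (∀ p < i, p ∈ β ↔ p ∈ α) ∧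
      dSet (insert (k + 1) (I.erase i)) (t (k + 1) (some α)) =
        if 2 ≤ i ∧ k = 0 then (t i (dSet I (some α))).map (fun l => 0 :: l)
        else t i (dSet I (some α)) := by
  have hi0 := hI i hi
  set A := I.filter (fun j => j < i) with hAdef
  set B := I.filter (fun j => i < j) with hBdef
  have hA : ∀ j ∈ A, 0 < j ∧ j < i := fun j hj => by
    rw [hAdef, Finset.mem_filter] at hj
    exact ⟨hI j hj.1, hj.2⟩
  have hB : ∀ j ∈ B, i < j := fun j hj => (Finset.mem_filter.mp hj).2
  have hsplit : ∀ c, c ≤ i → (∀ j ∈ A, j < c) → ∀ o,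
      dSet (insert c (I.erase i)) o = dSet A (d c (dSet B o)) := by
    intro c hc hAc o
    have hU : insert c (I.erase i) = (A ∪ {c}) ∪ B := by
      ext x
      simp only [hAdef, hBdef, Finset.mem_union, Finset.mem_insert, Finset.mem_erase,
        Finset.mem_filter, Finset.mem_singleton]
      grind
    rw [hU, dSet_union, dSet_union, dSet_singleton]
    · simpa using hAc
    · intro a ha b hb
      have := hB b hb
      rw [Finset.mem_union, Finset.mem_singleton] at ha
      obtain ha | rfl := ha
      · have := hA a ha; omega
      · omega
  have hwI : dSet I (some α) = dSet A (d i (dSet B (some α))) := by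
    rw [← hsplit i le_rfl (fun j hj => (hA j hj).2), Finset.insert_erase hi]
  rw [hwI] at hw ⊢
  cases hβ : dSet B (some α) with
  | none => rw [hβ, d_none, dSet_none, t_none] at hw; exact absurd rfl hw
  | some β =>
  rw [hβ] at hw
  have hmem : ∀ p < i, p ∈ β ↔ p ∈ α := fun p hp =>
    mem_iff_of_dSet_eq_some (fun j hj => by have := hB j hj; omega) hβ
  have hiβ : i ∈ β := by
    by_contra hc
    rw [d_of_pos hi0, Option.bind_some, removeAux_eq_none.mpr hc, dSet_none, t_none] at hw
    exact hw rfl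
  have hBt : dSet B (t (k + 1) (some α)) = t (k + 1) (some β) := by
    rw [← hβ]
    refine dSet_comm (fun j hj o => ?_) _
    have := hB j hj
    exact d_t_comm (by omega) (by omega) (by omega) (by omega) o
  refine ⟨β, rfl, hiβ, hmem, ?_⟩
  by_cases hki' : k + 1 = i
  · subst hki'
    rw [hsplit _ le_rfl (fun j hj => (hA j hj).2), hBt, if_neg (by omega)]
    obtain rfl | hk0 := Nat.eq_zero_or_pos k
    · have hAe : A = ∅ := Finset.eq_empty_of_forall_notMem fun j hj => by
        have := hA j hj; omega
      obtain ⟨γ, hγ⟩ := exists_removeAux hiβ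
      simp only [zero_add] at hγ
      simp [hAe, dSet, t, d, removeAux, hγ]
    · exact dSet_d_t_of_mem (by omega) hA hiβ
        ((hmem _ (by omega)).mpr (by simpa using hk.resolve_left (by omega)))
  · have hi2 : 2 ≤ i := by omega
    have hgap : ∀ p ∈ β, p < i → p ≤ k := fun p hp hpi => hmax p ((hmem p hpi).mp hp) hpi
    have heq := t_dSet_d_of_notMem hi2 hA hiβ
      (fun h => by have := hgap _ h (by omega); omega) hw
    rw [heq] at hw ⊢
    have hAk := le_of_dSet_ne_none hA hgap hw
    have hk1 : k + 1 ∉ β := fun h => by have := hgap _ h (by omega); omega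
    rw [hsplit _ (by omega) (fun j hj => Nat.lt_succ_of_le (hAk j hj)), hBt]
    obtain rfl | hk0 := Nat.eq_zero_or_pos k
    · have hAe : A = ∅ := Finset.eq_empty_of_forall_notMem fun j hj => by
        have := hA j hj; have := hAk j hj; omega
      rw [if_pos ⟨hi2, rfl⟩]
      rw [zero_add, ← removeAux_eq_none] at hk1
      simp [hAe, dSet, t, d, removeAux, hk1]
    · rw [if_neg (by omega), t_of_two_le (by omega), Nat.add_sub_cancel]
      exact congrArg (dSet A) (removeAux_succ_addAux
        ((hmem k hki).mpr (hk.resolve_left (by omega))) hk1)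

/-- Lemma 3.8: properties of `Φ`. Let `α` be a composition, `w = 𝔱ᵢ 𝔡_I` with
`i ∈ I` and `w(α) ≠ 0`, write `I = A ⊔ {i} ⊔ B` with `A = {j ∈ I : j < i}`,
`B = {j ∈ I : j > i}`, let `k` be the largest part of `α` strictly less than `i`
(`k = 0` if none), `i' = k + 1`, `I' = A ⊔ {i'} ⊔ B`, and `w' = Φ(w) = 𝔡_{I'} 𝔱_{i'}`.
Then: (1) `w'(α) = w(α)` if `i = 1`; (2) `w'(α) = w(α)` if `i ≥ 2` and `i` is not the
smallest part of `𝔡_B(α)`; (3) `w'(α) = (0, w(α))` if `i ≥ 2` and `i` is the smallest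
part of `𝔡_B(α)`. In particular `w'(α) ≠ 0` and the underlying compositions of
`w'(α)` and `w(α)` agree. -/
theorem properties_of_Phi (α : List ℕ) (hα : ∀ x ∈ α, 0 < x)
    (I : Finset ℕ) (hI : ∀ j ∈ I, 0 < j) (i : ℕ) (hi : i ∈ I)
    (hw : t i (dSet I (some α)) ≠ none) :
    let B := I.filter (fun j => i < j)
    let k := (α.filter (fun p => p < i)).foldr max 0
    let i' := k + 1
    let I' := insert i' (I.erase i)
    (i = 1 → dSet I' (t i' (some α)) = t i (dSet I (some α))) ∧
    (∀ β : List ℕ, dSet B (some α) = some β →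
      (2 ≤ i → ¬(i ∈ β ∧ ∀ p ∈ β, i ≤ p) →
        dSet I' (t i' (some α)) = t i (dSet I (some α))) ∧
      (2 ≤ i → (i ∈ β ∧ ∀ p ∈ β, i ≤ p) →
        dSet I' (t i' (some α)) = (t i (dSet I (some α))).map (fun l => 0 :: l))) ∧
    dSet I' (t i' (some α)) ≠ none ∧
    (dSet I' (t i' (some α))).map (List.filter (fun x => 0 < x)) =
      (t i (dSet I (some α))).map (List.filter (fun x => 0 < x)) := by
  intro B k i' I'
  have hi0 := hI i hi
  have hk : k = 0 ∨ k ∈ α.filter (fun p => p < i) := foldr_max_eq_zero_or_mem _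
  have hki : k < i := by
    obtain hk | hk := hk
    · omega
    · simpa using (List.mem_filter.mp hk).2
  have hmax : ∀ p ∈ α, p < i → p ≤ k := fun p hp hpi =>
    le_foldr_max (List.mem_filter.mpr ⟨hp, by simpa using hpi⟩)
  obtain ⟨β, hβ, hiβ, hmem, heq⟩ := dSet_insert_t_eq hI hi hw hki
    (hk.imp_right fun h => (List.mem_filter.mp h).1) hmax
  have hsmall : (i ∈ β ∧ ∀ p ∈ β, i ≤ p) ↔ k = 0 := by
    constructor
    · intro h
      refine hk.resolve_right fun hk => ?_
      have := h.2 k ((hmem k hki).mpr (List.mem_filter.mp hk).1)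
      omega
    · refine fun h => ⟨hiβ, fun p hp => ?_⟩
      by_contra! hpi
      have hp' := (hmem p hpi).mp hp
      have := hmax p hp' hpi
      have := hα p hp'
      omega
  change dSet I' (t i' (some α)) = _ at heq
  refine ⟨fun h => ?_, fun β' hβ' => ?_, ?_, ?_⟩
  · rw [heq, if_neg (by omega)]
  · obtain rfl : β = β' := Option.some.inj (hβ.symm.trans hβ')
    rw [hsmall]
    refine ⟨fun h2 hk0 => ?_, fun h2 hk0 => ?_⟩
    · rw [heq, if_neg (by tauto)]
    · rw [heq, if_pos ⟨h2, hk0⟩]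
  · rw [heq]
    split_ifs
    · simpa using hw
    · exact hw
  · rw [heq]
    split_ifs
    · rw [Option.map_map]
      rfl
    · rfl

end CompOps
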